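/- arXiv:1108.4333 — 3 statements merged into one kernel-verified Lean document; each statement's English description precedes it below -/
import Mathlib

section
/- Anholonomy relations for N-adapted frames (coefficient form): for all α, β ∈ Fin m and A, B ∈ Fin m, and every smooth function f : ℝⁿ × ℝᵐ → ℝ, one has (δ_α∘δ_β − δ_β∘δ_α) f = C^γ_{αβ} · δ_γ f + Ω^A_{αβ} · V_A f, (δ_α∘V_B − V_B∘δ_α) f = (∂N^A_α/∂y^B) · V_A f, and (V_A∘V_B − V_B∘V_A) f = 0, where Ω^A_{αβ} := δ_β N^A_α − δ_α N^A_β + C^γ_{αβ} N^A_γ. -/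
/- STATEMENT 0: Anholonomy relations for N-adapted frames (coefficient form). -/

noncomputable section

/-- Points of `ℝⁿ × ℝᵐ` with coordinates `(xⁱ, y^A)`. -/
abbrev Pt (n m : ℕ) := (Fin n → ℝ) × (Fin m → ℝ)

/-- Smooth scalar functions on `ℝⁿ × ℝᵐ`. -/
abbrev Fn (n m : ℕ) := Pt n m → ℝ

/-- Partial derivative `∂f/∂xⁱ`. -/
def px {n m : ℕ} (i : Fin n) (f : Fn n m) (p : Pt n m) : ℝ :=
  fderiv ℝ f p (Pi.single i 1, 0)

/-- Partial derivative `∂f/∂y^A`, i.e. the operator `V_A`. -/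
def py {n m : ℕ} (A : Fin m) (f : Fn n m) (p : Pt n m) : ℝ :=
  fderiv ℝ f p (0, Pi.single A 1)

/-- Partial derivative `∂g/∂xⁱ` for a function of `x` only. -/
def pd {n : ℕ} (i : Fin n) (g : (Fin n → ℝ) → ℝ) (x : Fin n → ℝ) : ℝ :=
  fderiv ℝ g x (Pi.single i 1)

/-- The N-adapted operator `δ_α f := ρⁱ_α ∂f/∂xⁱ − N^A_α ∂f/∂y^A`. -/
def del {n m : ℕ} (ρ : Fin n → Fin m → (Fin n → ℝ) → ℝ)
    (N : Fin m → Fin m → Fn n m) (α : Fin m) (f : Fn n m) (p : Pt n m) : ℝ :=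
  (∑ i, ρ i α p.1 * px i f p) - ∑ A, N A α p * py A f p

/-- The N-connection curvature coefficients
`Ω^A_{αβ} := δ_β N^A_α − δ_α N^A_β + C^γ_{αβ} N^A_γ`. -/
def Om {n m : ℕ} (ρ : Fin n → Fin m → (Fin n → ℝ) → ℝ)
    (C : Fin m → Fin m → Fin m → (Fin n → ℝ) → ℝ)
    (N : Fin m → Fin m → Fn n m) (A α β : Fin m) (p : Pt n m) : ℝ :=
  del ρ N β (N A α) p - del ρ N α (N A β) p + ∑ γ, C γ α β p.1 * N A γ p

/-- The commutator of two directional derivatives is the derivative along the Lie bracket. -/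
theorem fderiv_comm_eq_fderiv_lieBracket {E : Type*} [NormedAddCommGroup E] [NormedSpace ℝ E]
    {f : E → ℝ} {V W : E → E} {p : E} (hf : ContDiff ℝ 2 f)
    (hV : DifferentiableAt ℝ V p) (hW : DifferentiableAt ℝ W p) :
    fderiv ℝ (fun q => fderiv ℝ f q (W q)) p (V p) - fderiv ℝ (fun q => fderiv ℝ f q (V q)) p (W p)
      = fderiv ℝ f p (VectorField.lieBracket ℝ V W p) :=
  (VectorField.fderiv_apply_lieBracket_of_isSymmSndFDerivAt hf.contDiffAt
    (hf.contDiffAt.isSymmSndFDerivAt (by simp)) hW hV).symm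

theorem fderiv_eq_sum_px_add_sum_py {n m : ℕ} (f : Fn n m) (p v : Pt n m) :
    fderiv ℝ f p v = (∑ i, v.1 i * px i f p) + ∑ A, v.2 A * py A f p := by
  have hv : v = (∑ i, v.1 i • ((Pi.single i 1, 0) : Pt n m))
      + ∑ A, v.2 A • ((0, Pi.single A 1) : Pt n m) := by
    ext j <;> simp [Prod.fst_sum, Prod.snd_sum, Pi.single_apply]
  conv_lhs => rw [hv]
  simp only [map_add, map_sum, map_smul, smul_eq_mul, px, py]

/-- The vector field `ρⁱ_α ∂/∂xⁱ − N^A_α ∂/∂y^A`. -/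
def delField {n m : ℕ} (ρ : Fin n → Fin m → (Fin n → ℝ) → ℝ)
    (N : Fin m → Fin m → Fn n m) (α : Fin m) (p : Pt n m) : Pt n m :=
  (fun i => ρ i α p.1, fun A => - N A α p)

theorem del_eq_fderiv {n m : ℕ} (ρ : Fin n → Fin m → (Fin n → ℝ) → ℝ)
    (N : Fin m → Fin m → Fn n m) (α : Fin m) (f : Fn n m) (p : Pt n m) :
    del ρ N α f p = fderiv ℝ f p (delField ρ N α p) := by
  simp [fderiv_eq_sum_px_add_sum_py, del, delField, sub_eq_add_neg]

theorem hasFDerivAt_delField {n m : ℕ} {ρ : Fin n → Fin m → (Fin n → ℝ) → ℝ}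
    {N : Fin m → Fin m → Fn n m} (hρ : ∀ i α, Differentiable ℝ (ρ i α))
    (hN : ∀ A α, Differentiable ℝ (N A α)) (α : Fin m) (p : Pt n m) :
    HasFDerivAt (delField ρ N α)
      ((ContinuousLinearMap.pi fun i =>
          (fderiv ℝ (ρ i α) p.1).comp (ContinuousLinearMap.fst ℝ _ _)).prod
        (ContinuousLinearMap.pi fun A => - fderiv ℝ (N A α) p)) p :=
  (hasFDerivAt_pi.2 fun i => ((hρ i α) p.1).hasFDerivAt.comp p hasFDerivAt_fst).prodMk
    (hasFDerivAt_pi.2 fun A => ((hN A α) p).hasFDerivAt.neg)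

theorem fderiv_eq_sum_pd {n : ℕ} (g : (Fin n → ℝ) → ℝ) (x v : Fin n → ℝ) :
    fderiv ℝ g x v = ∑ i, v i * pd i g x := by
  conv_lhs => rw [pi_eq_sum_univ' v]
  simp only [map_sum, map_smul, smul_eq_mul, pd]

theorem anholonomy_relations {n m : ℕ}
    (ρ : Fin n → Fin m → (Fin n → ℝ) → ℝ)
    (C : Fin m → Fin m → Fin m → (Fin n → ℝ) → ℝ)
    (N : Fin m → Fin m → Fn n m)
    (hρ : ∀ i α, ContDiff ℝ (⊤ : ℕ∞) (ρ i α))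
    (hC : ∀ γ α β, ContDiff ℝ (⊤ : ℕ∞) (C γ α β))
    (hCanti : ∀ γ α β x, C γ α β x = - C γ β α x)
    (hstruct : ∀ j α β x,
      (∑ i, ρ i α x * pd i (ρ j β) x) - ∑ i, ρ i β x * pd i (ρ j α) x
        = ∑ γ, ρ j γ x * C γ α β x)
    (hN : ∀ A α, ContDiff ℝ (⊤ : ℕ∞) (N A α))
    (f : Fn n m) (hf : ContDiff ℝ (⊤ : ℕ∞) f) :
    (∀ α β : Fin m, ∀ p : Pt n m,
      del ρ N α (del ρ N β f) p - del ρ N β (del ρ N α f) p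
        = (∑ γ, C γ α β p.1 * del ρ N γ f p) + ∑ A, Om ρ C N A α β p * py A f p)
    ∧ (∀ α B : Fin m, ∀ p : Pt n m,
      del ρ N α (py B f) p - py B (del ρ N α f) p
        = ∑ A, py B (N A α) p * py A f p)
    ∧ (∀ A B : Fin m, ∀ p : Pt n m,
      py A (py B f) p - py B (py A f) p = 0) := by
  have hf2 : ContDiff ℝ 2 f := contDiff_infty.1 hf 2
  have dρ : ∀ i α, Differentiable ℝ (ρ i α) := fun i α => (hρ i α).differentiable (by simp)
  have dN : ∀ A α, Differentiable ℝ (N A α) := fun A α => (hN A α).differentiable (by simp)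
  have hX := hasFDerivAt_delField dρ dN
  have hdel : ∀ α (g : Fn n m), del ρ N α g = fun q => fderiv ℝ g q (delField ρ N α q) :=
    fun α g => funext (del_eq_fderiv ρ N α g)
  refine ⟨fun α β p => ?_, fun α B p => ?_, fun A B p => ?_⟩
  · have key := fderiv_comm_eq_fderiv_lieBracket hf2 (hX α p).differentiableAt
      (hX β p).differentiableAt
    rw [← hdel, ← hdel, ← del_eq_fderiv, ← del_eq_fderiv] at key
    rw [key, fderiv_eq_sum_px_add_sum_py]
    have h1 : ∀ i, (VectorField.lieBracket ℝ (delField ρ N α) (delField ρ N β) p).1 i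
        = ∑ γ, ρ i γ p.1 * C γ α β p.1 := fun i => by
      rw [← hstruct, VectorField.lieBracket, (hX α p).fderiv, (hX β p).fderiv]
      simp [fderiv_eq_sum_pd, delField]
    have h2 : ∀ A, (VectorField.lieBracket ℝ (delField ρ N α) (delField ρ N β) p).2 A
        = del ρ N β (N A α) p - del ρ N α (N A β) p := fun A => by
      rw [VectorField.lieBracket, (hX α p).fderiv, (hX β p).fderiv, del_eq_fderiv, del_eq_fderiv]
      simp
      ring
    have h3 : ∑ γ, C γ α β p.1 * del ρ N γ f p
        = (∑ i, (∑ γ, ρ i γ p.1 * C γ α β p.1) * px i f p)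
          - ∑ A, (∑ γ, C γ α β p.1 * N A γ p) * py A f p := by
      simp only [del, mul_sub, Finset.sum_sub_distrib, Finset.mul_sum, Finset.sum_mul]
      congr 1 <;> rw [Finset.sum_comm] <;>
        exact Finset.sum_congr rfl fun _ _ => Finset.sum_congr rfl fun _ _ => by ring
    simp only [h1, h2, h3, Om, add_mul, Finset.sum_add_distrib]
    ring
  · have key := fderiv_comm_eq_fderiv_lieBracket hf2 (hX α p).differentiableAt
      (differentiableAt_const (c := ((0, Pi.single B 1) : Pt n m)))
    rw [← hdel, ← del_eq_fderiv] at key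
    refine key.trans ?_
    rw [fderiv_eq_sum_px_add_sum_py, VectorField.lieBracket, (hX α p).fderiv]
    simp [py]
  · refine (fderiv_comm_eq_fderiv_lieBracket hf2
      (differentiableAt_const (c := ((0, Pi.single A 1) : Pt n m)))
      (differentiableAt_const (c := ((0, Pi.single B 1) : Pt n m)))).trans ?_
    simp [VectorField.lieBracket]
end
end

section
/- Integral curves of the canonical semispray solve the Euler–Lagrange equations: let L : ℝⁿ × ℝᵐ → ℝ be smooth with Hessian ϖ_{αβ} := ∂²L/∂y^α∂y^β invertible at every point, and let φ^ε := ϖ^{εβ} ( ρ^i_β ∂L/∂x^i − ρ^i_α (∂²L/∂x^i∂y^β) y^α − C^γ_{βα} (∂L/∂y^γ) y^α ). If a differentiable curve c(τ) = (x^i(τ), y^α(τ)) in ℝⁿ × ℝᵐ satisfies dx^i/dτ = ρ^i_α(x(τ)) y^α(τ) and dy^α/dτ = φ^α(x(τ), y(τ)), then for every α and every τ it satisfies the Euler–Lagrange equations (d/dτ)( ∂L/∂y^α (x(τ), y(τ)) ) + y^β(τ) C^γ_{αβ}(x(τ)) (∂L/∂y^γ)(x(τ), y(τ)) − ρ^i_α(x(τ))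 (∂L/∂x^i)(x(τ), y(τ)) = 0. -/
/- STATEMENT 6: Integral curves of the canonical semispray solve the
Euler–Lagrange equations on the Lie algebroid. -/

noncomputable section

/-- The Hessian `ϖ_{αβ} := ∂²L/∂y^α∂y^β`. -/
def Hess {n m : ℕ} (L : Fn n m) (α β : Fin m) : Fn n m :=
  py α (py β L)

/-- The canonical semispray coefficients
`φ^ε := ϖ^{εβ} (ρⁱ_β ∂L/∂xⁱ − ρⁱ_α (∂²L/∂xⁱ∂y^β) y^α − C^γ_{βα} (∂L/∂y^γ) y^α)`. -/
def semispray {n m : ℕ} (ρ : Fin n → Fin m → (Fin n → ℝ) → ℝ)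
    (C : Fin m → Fin m → Fin m → (Fin n → ℝ) → ℝ)
    (L : Fn n m) (ϖinv : Fin m → Fin m → Fn n m) (ε : Fin m) (p : Pt n m) : ℝ :=
  ∑ β, ϖinv ε β p *
    ((∑ i, ρ i β p.1 * px i L p)
      - (∑ α, ∑ i, ρ i α p.1 * px i (py β L) p * p.2 α)
      - ∑ α, ∑ γ, C γ β α p.1 * py γ L p * p.2 α)

/-- The partial derivatives determine the full derivative. -/
theorem fderiv_apply_eq_sum_px_add_sum_py {n m : ℕ} (f : Fn n m) (p v : Pt n m) :
    fderiv ℝ f p v = (∑ i, v.1 i * px i f p) + ∑ α, v.2 α * py α f p := by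
  have hv : v = (∑ i, v.1 i • ((Pi.single i 1, 0) : Pt n m))
      + ∑ α, v.2 α • ((0, Pi.single α 1) : Pt n m) := by
    ext j <;> simp [Prod.fst_sum, Prod.snd_sum, Finset.sum_apply, Pi.single_apply]
  conv_lhs => rw [hv]
  simp only [map_add, map_sum, map_smul, smul_eq_mul, px, py]

theorem differentiable_py {n m : ℕ} {L : Fn n m} (hL : ContDiff ℝ 2 L) (α : Fin m) :
    Differentiable ℝ (py α L) :=
  ((hL.fderiv_right (m := 1) (by norm_num)).clm_apply contDiff_const).differentiable (by norm_num)

theorem Hess_eq_fderiv_fderiv {n m : ℕ} {L : Fn n m} (hL : ContDiff ℝ 2 L) (α β : Fin m)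
    (p : Pt n m) :
    Hess L α β p = fderiv ℝ (fderiv ℝ L) p (0, Pi.single α 1) (0, Pi.single β 1) := by
  have hd : DifferentiableAt ℝ (fderiv ℝ L) p :=
    (hL.fderiv_right (m := 1) (by norm_num)).differentiable (by norm_num) p
  have h := hd.hasFDerivAt.clm_apply
    (hasFDerivAt_const ((0, Pi.single β 1) : Pt n m) p)
  change fderiv ℝ (fun q => fderiv ℝ L q (0, Pi.single β 1)) p (0, Pi.single α 1) = _
  rw [h.fderiv]
  simp

theorem Hess_symm {n m : ℕ} {L : Fn n m} (hL : ContDiff ℝ 2 L) (α β : Fin m) (p : Pt n m) :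
    Hess L α β p = Hess L β α p := by
  rw [Hess_eq_fderiv_fderiv hL, Hess_eq_fderiv_fderiv hL]
  exact (hL.contDiffAt.isSymmSndFDerivAt (by simp)).eq _ _

/-- The chain rule along a curve with prescribed component velocities. -/
theorem hasDerivAt_comp_of_components {n m : ℕ} {f : Fn n m} {c : ℝ → Pt n m} {τ : ℝ}
    (hf : DifferentiableAt ℝ f (c τ)) {u : Fin n → ℝ} {v : Fin m → ℝ}
    (hx : ∀ i, HasDerivAt (fun s => (c s).1 i) (u i) τ)
    (hy : ∀ α, HasDerivAt (fun s => (c s).2 α) (v α) τ) :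
    HasDerivAt (fun s => f (c s))
      ((∑ i, u i * px i f (c τ)) + ∑ α, v α * py α f (c τ)) τ := by
  have hc : HasDerivAt c (u, v) τ := (hasDerivAt_pi.2 hx).prodMk (hasDerivAt_pi.2 hy)
  have h := hf.hasFDerivAt.comp_hasDerivAt τ hc
  rwa [fderiv_apply_eq_sum_px_add_sum_py] at h

/-- Contracting the semispray coefficients with the Hessian removes the inverse Hessian. -/
theorem sum_Hess_mul_semispray {n m : ℕ} (ρ : Fin n → Fin m → (Fin n → ℝ) → ℝ)
    (C : Fin m → Fin m → Fin m → (Fin n → ℝ) → ℝ) (L : Fn n m) (ϖinv : Fin m → Fin m → Fn n m)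
    (p : Pt n m)
    (hϖinv : ∀ α β, (∑ φ, Hess L α φ p * ϖinv φ β p) = if α = β then (1:ℝ) else 0) (β : Fin m) :
    ∑ ε, Hess L β ε p * semispray ρ C L ϖinv ε p =
      (∑ i, ρ i β p.1 * px i L p)
      - (∑ α, ∑ i, ρ i α p.1 * px i (py β L) p * p.2 α)
      - ∑ α, ∑ γ, C γ β α p.1 * py γ L p * p.2 α := by
  simp only [semispray, Finset.mul_sum]
  rw [Finset.sum_comm]
  simp only [← mul_assoc, ← Finset.sum_mul, hϖinv]
  simp

theorem integral_curves_solve_euler_lagrange {n m : ℕ}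
    (ρ : Fin n → Fin m → (Fin n → ℝ) → ℝ)
    (C : Fin m → Fin m → Fin m → (Fin n → ℝ) → ℝ)
    (hρ : ∀ i α, ContDiff ℝ (⊤ : ℕ∞) (ρ i α))
    (hC : ∀ γ α β, ContDiff ℝ (⊤ : ℕ∞) (C γ α β))
    (hCanti : ∀ γ α β x, C γ α β x = - C γ β α x)
    (L : Fn n m) (hL : ContDiff ℝ (⊤ : ℕ∞) L)
    -- regularity: the Hessian has a pointwise inverse `ϖinv`
    (ϖinv : Fin m → Fin m → Fn n m)
    (hϖinv : ∀ p : Pt n m, ∀ α β,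
      (∑ φ, Hess L α φ p * ϖinv φ β p) = if α = β then (1:ℝ) else 0)
    (hϖinv' : ∀ p : Pt n m, ∀ α β,
      (∑ φ, ϖinv α φ p * Hess L φ β p) = if α = β then (1:ℝ) else 0)
    -- a differentiable curve `c(τ) = (xⁱ(τ), y^α(τ))`
    (c : ℝ → Pt n m)
    (hc : Differentiable ℝ c)
    -- the curve is an integral curve of the semispray section:
    -- `dxⁱ/dτ = ρⁱ_α y^α` and `dy^α/dτ = φ^α`
    (hx : ∀ i : Fin n, ∀ τ : ℝ,
      HasDerivAt (fun s => (c s).1 i) (∑ α, ρ i α (c τ).1 * (c τ).2 α) τ)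
    (hy : ∀ α : Fin m, ∀ τ : ℝ,
      HasDerivAt (fun s => (c s).2 α) (semispray ρ C L ϖinv α (c τ)) τ) :
    -- conclusion: the Euler–Lagrange equations hold along the curve
    ∀ α : Fin m, ∀ τ : ℝ,
      deriv (fun s => py α L (c s)) τ
        + (∑ β, (c τ).2 β * ∑ γ, C γ α β (c τ).1 * py γ L (c τ))
        - (∑ i, ρ i α (c τ).1 * px i L (c τ)) = 0 := by
  intro β τ
  have hL2 : ContDiff ℝ 2 L := contDiff_infty.1 hL 2
  have hd := hasDerivAt_comp_of_components (differentiable_py hL2 β (c τ))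
    (fun i => hx i τ) (fun α => hy α τ)
  have hs := sum_Hess_mul_semispray ρ C L ϖinv (c τ) (hϖinv (c τ)) β
  have hH : ∑ ε, semispray ρ C L ϖinv ε (c τ) * py ε (py β L) (c τ)
      = ∑ ε, Hess L β ε (c τ) * semispray ρ C L ϖinv ε (c τ) :=
    Finset.sum_congr rfl fun ε _ => by rw [Hess_symm hL2 β ε, Hess, mul_comm]
  have hX : ∑ i, (∑ α, ρ i α (c τ).1 * (c τ).2 α) * px i (py β L) (c τ)
      = ∑ α, ∑ i, ρ i α (c τ).1 * px i (py β L) (c τ) * (c τ).2 α := by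
    simp only [Finset.sum_mul]
    rw [Finset.sum_comm]
    simp only [mul_right_comm]
  have hCy : ∑ α, (c τ).2 α * ∑ γ, C γ β α (c τ).1 * py γ L (c τ)
      = ∑ α, ∑ γ, C γ β α (c τ).1 * py γ L (c τ) * (c τ).2 α := by
    simp only [← Finset.sum_mul, mul_comm]
  rw [hd.deriv, hH, hs, hX, hCy]
  ring
end
end

section
/- Canonical d-connection: define L̂^α_{βγ} := (1/2) g^{ατ} ( δ_γ g_{βτ} + δ_β g_{γτ} − δ_τ g_{βγ} ) + (1/2) g^{ατ} ( g_{βε} C^ε_{τγ} + g_{γε} C^ε_{τβ} − g_{τε} C^ε_{βγ} ), L̂^A_{Bγ} := V_B(N^A_γ) + (1/2) g^{AC} ( δ_γ g_{BC} − g_{DC} V_B(N^D_γ) − g_{DB} V_C(N^D_γ) ), B̂^α_{βC} := (1/2) g^{ατ} V_C g_{βτ}, and B̂^A_{BC} := (1/2) g^{AD} ( V_C g_{BD} + V_B g_{CD} − V_D g_{BC} ). Then: (i) all four metric-compatibility equations hold: δ_γ g_{αβ} = L̂^τ_{αγ} g_{τβ} + L̂^τ_{βγ} g_{ατ}; δ_γ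 g_{AB} = L̂^C_{Aγ} g_{CB} + L̂^C_{Bγ} g_{AC}; V_C g_{αβ} = B̂^τ_{αC} g_{τβ} + B̂^τ_{βC} g_{ατ}; V_C g_{AB} = B̂^D_{AC} g_{DB} + B̂^D_{BC} g_{AD}; (ii) the vertical torsion vanishes: B̂^A_{BC} = B̂^A_{CB}; and (iii) the horizontal antisymmetric part is prescribed by the structure functions: L̂^α_{βγ} − L̂^α_{γβ} = −C^α_{βγ}. -/
/- STATEMENT 8: The canonical d-connection: metric compatibility, vanishing
vertical torsion, and prescribed horizontal antisymmetric part. -/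

noncomputable section

/-- The canonical h–h coefficients `L̂^α_{βγ}`. -/
def Lhat {n m : ℕ} (ρ : Fin n → Fin m → (Fin n → ℝ) → ℝ)
    (C : Fin m → Fin m → Fin m → (Fin n → ℝ) → ℝ)
    (N : Fin m → Fin m → Fn n m) (gh ghinv : Fin m → Fin m → Fn n m)
    (α β γ : Fin m) (p : Pt n m) : ℝ :=
  (1/2) * (∑ τ, ghinv α τ p *
      (del ρ N γ (gh β τ) p + del ρ N β (gh γ τ) p - del ρ N τ (gh β γ) p))
  + (1/2) * ∑ τ, ghinv α τ p *
      ((∑ ε, gh β ε p * C ε τ γ p.1) + (∑ ε, gh γ ε p * C ε τ β p.1)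
        - ∑ ε, gh τ ε p * C ε β γ p.1)

/-- The canonical v–h coefficients `L̂^A_{Bγ}`. -/
def Lvhat {n m : ℕ} (ρ : Fin n → Fin m → (Fin n → ℝ) → ℝ)
    (N : Fin m → Fin m → Fn n m) (gv gvinv : Fin m → Fin m → Fn n m)
    (A B γ : Fin m) (p : Pt n m) : ℝ :=
  py B (N A γ) p
  + (1/2) * ∑ c, gvinv A c p *
      (del ρ N γ (gv B c) p - (∑ d, gv d c p * py B (N d γ) p)
        - ∑ d, gv d B p * py c (N d γ) p)

/-- The canonical h–v coefficients `B̂^α_{βC}`. -/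
def Bhhat {n m : ℕ} (gh ghinv : Fin m → Fin m → Fn n m)
    (α β c : Fin m) (p : Pt n m) : ℝ :=
  (1/2) * ∑ τ, ghinv α τ p * py c (gh β τ) p

/-- The canonical v–v coefficients `B̂^A_{BC}`. -/
def Bvhat {n m : ℕ} (gv gvinv : Fin m → Fin m → Fn n m)
    (A B c : Fin m) (p : Pt n m) : ℝ :=
  (1/2) * ∑ d, gvinv A d p *
      (py c (gv B d) p + py B (gv c d) p - py d (gv B c) p)

/-- Lowering an index that was raised with the inverse matrix gives back the original covector. -/
theorem sum_raise_mul_eq {ι : Type*} [Fintype ι] [DecidableEq ι] {g ginv : ι → ι → ℝ}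
    (h : ∀ a b, (∑ t, g a t * ginv t b) = if a = b then (1 : ℝ) else 0) (X : ι → ℝ) (b : ι) :
    ∑ t, (∑ s, ginv t s * X s) * g b t = X b := by
  calc ∑ t, (∑ s, ginv t s * X s) * g b t
      = ∑ s, (∑ t, g b t * ginv t s) * X s := by
        simp only [Finset.sum_mul]
        rw [Finset.sum_comm]
        exact Finset.sum_congr rfl fun _ _ => Finset.sum_congr rfl fun _ _ => by ring
    _ = X b := by simp [h]

/-- If lowering the upper index of `Γ` gives coefficients `X` whose symmetrization is `D`, then `Γ`
satisfies the metric-compatibility equation with `D` as the derivative of `g`. -/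
theorem compatible_of_lowered {ι : Type*} [Fintype ι] {g : ι → ι → ℝ}
    (hsym : ∀ a b, g a b = g b a) {Γ X D : ι → ι → ℝ}
    (hlow : ∀ a b, ∑ t, Γ t a * g b t = X a b) (hX : ∀ a b, X a b + X b a = D a b) (a b : ι) :
    D a b = (∑ t, Γ t a * g t b) + ∑ t, Γ t b * g a t := by
  have h : ∑ t, Γ t a * g t b = X a b := by
    rw [← hlow]
    exact Finset.sum_congr rfl fun t _ => by rw [hsym t b]
  rw [h, hlow, hX]

theorem canonical_d_connection {n m : ℕ}
    (ρ : Fin n → Fin m → (Fin n → ℝ) → ℝ)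
    (C : Fin m → Fin m → Fin m → (Fin n → ℝ) → ℝ)
    (hρ : ∀ i α, ContDiff ℝ (⊤ : ℕ∞) (ρ i α))
    (hC : ∀ γ α β, ContDiff ℝ (⊤ : ℕ∞) (C γ α β))
    (hCanti : ∀ γ α β x, C γ α β x = - C γ β α x)
    (N : Fin m → Fin m → Fn n m) (hN : ∀ A α, ContDiff ℝ (⊤ : ℕ∞) (N A α))
    -- the d-metric: smooth, symmetric, pointwise invertible blocks
    (gh ghinv gv gvinv : Fin m → Fin m → Fn n m)
    (hgh : ∀ α β, ContDiff ℝ (⊤ : ℕ∞) (gh α β)) (hghsym : ∀ α β p, gh α β p = gh β α p)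
    (hgv : ∀ A B, ContDiff ℝ (⊤ : ℕ∞) (gv A B)) (hgvsym : ∀ A B p, gv A B p = gv B A p)
    (hghinv : ∀ p : Pt n m, ∀ α β,
      (∑ τ, gh α τ p * ghinv τ β p) = if α = β then (1:ℝ) else 0)
    (hghinv' : ∀ p : Pt n m, ∀ α β,
      (∑ τ, ghinv α τ p * gh τ β p) = if α = β then (1:ℝ) else 0)
    (hgvinv : ∀ p : Pt n m, ∀ A B,
      (∑ c, gv A c p * gvinv c B p) = if A = B then (1:ℝ) else 0)
    (hgvinv' : ∀ p : Pt n m, ∀ A B,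
      (∑ c, gvinv A c p * gv c B p) = if A = B then (1:ℝ) else 0) :
    -- (i) the four metric-compatibility equations
    ((∀ α β γ : Fin m, ∀ p : Pt n m,
        del ρ N γ (gh α β) p
          = (∑ τ, Lhat ρ C N gh ghinv τ α γ p * gh τ β p)
            + ∑ τ, Lhat ρ C N gh ghinv τ β γ p * gh α τ p)
      ∧ (∀ A B γ : Fin m, ∀ p : Pt n m,
        del ρ N γ (gv A B) p
          = (∑ c, Lvhat ρ N gv gvinv c A γ p * gv c B p)
            + ∑ c, Lvhat ρ N gv gvinv c B γ p * gv A c p)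
      ∧ (∀ α β c : Fin m, ∀ p : Pt n m,
        py c (gh α β) p
          = (∑ τ, Bhhat gh ghinv τ α c p * gh τ β p)
            + ∑ τ, Bhhat gh ghinv τ β c p * gh α τ p)
      ∧ (∀ A B c : Fin m, ∀ p : Pt n m,
        py c (gv A B) p
          = (∑ d, Bvhat gv gvinv d A c p * gv d B p)
            + ∑ d, Bvhat gv gvinv d B c p * gv A d p))
    -- (ii) the vertical torsion vanishes
    ∧ (∀ A B c : Fin m, ∀ p : Pt n m,
        Bvhat gv gvinv A B c p = Bvhat gv gvinv A c B p)
    -- (iii) the horizontal antisymmetric part is prescribed by the structure functions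
    ∧ (∀ α β γ : Fin m, ∀ p : Pt n m,
        Lhat ρ C N gh ghinv α β γ p - Lhat ρ C N gh ghinv α γ β p
          = - C α β γ p.1) := by
  have hh : ∀ α β, gh α β = gh β α := fun α β => funext (hghsym α β)
  have hv : ∀ A B, gv A B = gv B A := fun A B => funext (hgvsym A B)
  have raise_half {g ginv : Fin m → Fin m → Fn n m} {p : Pt n m}
      (h : ∀ a b, (∑ t, g a t p * ginv t b p) = if a = b then (1 : ℝ) else 0)
      (X : Fin m → ℝ) (b : Fin m) :
      ∑ t, (1 / 2 * ∑ s, ginv t s p * X s) * g b t p = 1 / 2 * X b := by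
    simp only [mul_assoc, ← Finset.mul_sum]
    rw [sum_raise_mul_eq (g := fun a b => g a b p) (ginv := fun a b => ginv a b p) h]
  refine ⟨⟨?_, ?_, ?_, ?_⟩, ?_, ?_⟩
  · intro α β γ p
    refine compatible_of_lowered (g := fun a b => gh a b p) (fun a b => hghsym a b p)
      (Γ := fun t a => Lhat ρ C N gh ghinv t a γ p) (D := fun a b => del ρ N γ (gh a b) p)
      (X := fun a b =>
        1 / 2 * (del ρ N γ (gh a b) p + del ρ N a (gh γ b) p - del ρ N b (gh a γ) p)
        + 1 / 2 * ((∑ ε, gh a ε p * C ε b γ p.1) + (∑ ε, gh γ ε p * C ε b a p.1)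
          - ∑ ε, gh b ε p * C ε a γ p.1))
      (fun a b => ?_) (fun a b => ?_) α β
    · simp only [Lhat, add_mul, Finset.sum_add_distrib]
      rw [raise_half (hghinv p), raise_half (hghinv p)]
    · have hC' : ∑ ε, gh γ ε p * C ε b a p.1 = -∑ ε, gh γ ε p * C ε a b p.1 := by
        simp [hCanti _ b a]
      simp only [hC', hh b a, hh γ b, hh γ a]
      ring
  · intro A B γ p
    refine compatible_of_lowered (g := fun a b => gv a b p) (fun a b => hgvsym a b p)
      (Γ := fun t a => Lvhat ρ N gv gvinv t a γ p) (D := fun a b => del ρ N γ (gv a b) p)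
      (X := fun a b => (∑ d, gv d b p * py a (N d γ) p)
        + 1 / 2 * (del ρ N γ (gv a b) p - (∑ d, gv d b p * py a (N d γ) p)
          - ∑ d, gv d a p * py b (N d γ) p))
      (fun a b => ?_) (fun a b => ?_) A B
    · simp only [Lvhat, add_mul, Finset.sum_add_distrib]
      rw [raise_half (hgvinv p)]
      congr 1
      exact Finset.sum_congr rfl fun t _ => by rw [hv t b, mul_comm]
    · simp only [hv b a]
      ring
  · intro α β c p
    refine compatible_of_lowered (g := fun a b => gh a b p) (fun a b => hghsym a b p)
      (Γ := fun t a => Bhhat gh ghinv t a c p) (D := fun a b => py c (gh a b) p)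
      (X := fun a b => 1 / 2 * py c (gh a b) p)
      (fun a b => raise_half (hghinv p) _ b) (fun a b => ?_) α β
    simp only [hh b a]
    ring
  · intro A B c p
    refine compatible_of_lowered (g := fun a b => gv a b p) (fun a b => hgvsym a b p)
      (Γ := fun t a => Bvhat gv gvinv t a c p) (D := fun a b => py c (gv a b) p)
      (X := fun a b => 1 / 2 * (py c (gv a b) p + py a (gv c b) p - py b (gv a c) p))
      (fun a b => raise_half (hgvinv p) _ b) (fun a b => ?_) A B
    simp only [hv b a, hv c b, hv c a]
    ring
  · intro A B c p
    simp only [Bvhat, hv c B]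
    congr 1
    exact Finset.sum_congr rfl fun d _ => by ring
  · intro α β γ p
    have hraise : ∑ τ, ghinv α τ p * ∑ ε, gh τ ε p * C ε β γ p.1 = C α β γ p.1 := by
      simp only [Finset.mul_sum]
      rw [Finset.sum_comm]
      simp only [← mul_assoc, ← Finset.sum_mul, hghinv' p]
      simp
    have hC' : ∀ τ, ∑ ε, gh τ ε p * C ε γ β p.1 = -∑ ε, gh τ ε p * C ε β γ p.1 := fun τ => by
      simp [hCanti _ γ β]
    obtain ⟨K, hK⟩ : ∃ K : Fin m → Fin m → Fin m → ℝ,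
        ∀ a b d, ∑ ε, gh a ε p * C ε b d p.1 = K a b d := ⟨_, fun _ _ _ => rfl⟩
    rw [← hraise]
    simp only [Lhat, hC', hh γ β, hK]
    simp only [Finset.mul_sum, ← Finset.sum_add_distrib, ← Finset.sum_sub_distrib,
      ← Finset.sum_neg_distrib]
    exact Finset.sum_congr rfl fun τ _ => by ring
end
end
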